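/- Assume init j ≥ 0 for every j and every amount occurring in every list T p is nonnegative. Call a valid processing sequence S maximal if there is no event e not occurring in S such that S ++ [e] is valid. Then every maximal valid processing sequence contains every event that occurs in any valid processing sequence. (If one processing order processes a given transfer, every maximal processing order processes it.) -/

import Mathlib

/-- A money transfer: sender `s`, receiver `r`, amount `v`. -/
structure Transfer (n : ℕ) where
  s : Fin n
  r : Fin n
  v : ℤ

/-- Total money transferred to `j` in `L`. -/
def plus {n : ℕ} (j : Fin n) (L : List (Transfer n)) : ℤ :=
  ((L.filter (fun t => decide (t.r = j))).map (fun t => t.v)).sum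

/-- Total money transferred from `j` in `L`. -/
def minus {n : ℕ} (j : Fin n) (L : List (Transfer n)) : ℤ :=
  ((L.filter (fun t => decide (t.s = j))).map (fun t => t.v)).sum

/-- The value of `j`'s account after the transfers of `L`. -/
def acc {n : ℕ} (init : Fin n → ℤ) (j : Fin n) (L : List (Transfer n)) : ℤ :=
  init j + plus j L - minus j L

/-- The transfer induced by the event `(p, m)`: sender `p`, receiver and
amount given by the `m`-th transfer issued by `p` (i.e. the `m`-th entry
of `T p`). -/
def inducedTransfer {n : ℕ} (T : Fin n → List (Fin n × ℤ)) (e : Fin n × ℕ) :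
    Transfer n :=
  { s := e.1
    r := ((T e.1).getD e.2 (e.1, 0)).1
    v := ((T e.1).getD e.2 (e.1, 0)).2 }

/-- The induced transfer list of a processing sequence. -/
def inducedList {n : ℕ} (T : Fin n → List (Fin n × ℤ))
    (S : List (Fin n × ℕ)) : List (Transfer n) :=
  S.map (inducedTransfer T)

/-- `S` is a processing sequence: a duplicate-free list of events,
where an event is a pair `(p, m)` with `m < (T p).length`. -/
def IsProcSeq {n : ℕ} (T : Fin n → List (Fin n × ℤ))
    (S : List (Fin n × ℕ)) : Prop :=
  S.Nodup ∧ ∀ e ∈ S, e.2 < (T e.1).length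

/-- FIFO condition: whenever the event `(p, m)` occurs at some position of
`S`, every event `(p, m')` with `m' < m` occurs at an earlier position. -/
def FIFO {n : ℕ} (S : List (Fin n × ℕ)) : Prop :=
  ∀ (z : ℕ) (hz : z < S.length) (m' : ℕ), m' < (S[z]'hz).2 →
    ∃ (z' : ℕ) (hz' : z' < S.length), z' < z ∧ (S[z']'hz') = ((S[z]'hz).1, m')

/-- Balance condition: whenever an event occurs at position `z` of `S`, the
amount of its induced transfer is at most the sender's account computed from
the induced transfer list of the first `z` entries of `S`. -/
def Balance {n : ℕ} (init : Fin n → ℤ) (T : Fin n → List (Fin n × ℤ))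
    (S : List (Fin n × ℕ)) : Prop :=
  ∀ (z : ℕ) (hz : z < S.length),
    (inducedTransfer T (S[z]'hz)).v ≤
      acc init (S[z]'hz).1 (inducedList T (S.take z))

/-- A valid processing sequence. -/
def Valid {n : ℕ} (init : Fin n → ℤ) (T : Fin n → List (Fin n × ℤ))
    (S : List (Fin n × ℕ)) : Prop :=
  IsProcSeq T S ∧ FIFO S ∧ Balance init T S

/-- A valid processing sequence is maximal if it cannot be extended by any
further event while remaining valid. -/
def MaximalValid {n : ℕ} (init : Fin n → ℤ) (T : Fin n → List (Fin n × ℤ))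
    (S : List (Fin n × ℕ)) : Prop :=
  Valid init T S ∧ ∀ e : Fin n × ℕ, e ∉ S → ¬ Valid init T (S ++ [e])

theorem inducedTransfer_v_nonneg {n : ℕ} {T : Fin n → List (Fin n × ℤ)}
    (hT : ∀ p : Fin n, ∀ x ∈ T p, 0 ≤ x.2) (e : Fin n × ℕ) :
    0 ≤ (inducedTransfer T e).v := by
  unfold inducedTransfer
  by_cases h : e.2 < (T e.1).length
  · rw [List.getD_eq_getElem _ _ h]
    exact hT _ _ (List.getElem_mem h)
  · rw [List.getD_eq_default _ _ (not_lt.1 h)]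

theorem plus_append {n : ℕ} (j : Fin n) (L L' : List (Transfer n)) :
    plus j (L ++ L') = plus j L + plus j L' := by
  simp [plus]

theorem minus_append {n : ℕ} (j : Fin n) (L L' : List (Transfer n)) :
    minus j (L ++ L') = minus j L + minus j L' := by
  simp [minus]

theorem acc_perm {n : ℕ} (init : Fin n → ℤ) (j : Fin n) {L L' : List (Transfer n)}
    (h : L.Perm L') : acc init j L = acc init j L' := by
  unfold acc plus minus
  rw [((h.filter _).map _).sum_eq, ((h.filter _).map _).sum_eq]

theorem plus_nonneg {n : ℕ} (j : Fin n) {L : List (Transfer n)} (h : ∀ t ∈ L, 0 ≤ t.v) :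
    0 ≤ plus j L := by
  apply List.sum_nonneg
  intro x hx
  obtain ⟨t, ht, rfl⟩ := List.mem_map.1 hx
  exact h t (List.mem_filter.1 ht).1

theorem minus_eq_zero {n : ℕ} (j : Fin n) {L : List (Transfer n)} (h : ∀ t ∈ L, t.s ≠ j) :
    minus j L = 0 := by
  have : L.filter (fun t => decide (t.s = j)) = [] := by
    simpa [List.filter_eq_nil_iff] using h
  simp [minus, this]

/-- Processing further events, none of them issued by `j`, does not decrease `j`'s account. -/
theorem acc_le_acc_of_subset {n : ℕ} (init : Fin n → ℤ) {T : Fin n → List (Fin n × ℤ)}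
    (hT : ∀ p : Fin n, ∀ x ∈ T p, 0 ≤ x.2) {j : Fin n} {A B : List (Fin n × ℕ)}
    (hA : A.Nodup) (hB : B.Nodup) (hAB : A ⊆ B) (hj : ∀ e ∈ B, e.1 = j → e ∈ A) :
    acc init j (inducedList T A) ≤ acc init j (inducedList T B) := by
  set D := B.filter (fun e => decide (e ∉ A)) with hD
  have hperm : B.Perm (A ++ D) := by
    refine (List.perm_ext_iff_of_nodup hB ?_).2 ?_
    · refine List.Nodup.append hA (hB.filter _) ?_
      intro e he he'
      simp [hD] at he'
      exact he'.2 he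
    · intro e
      simp only [hD, List.mem_append, List.mem_filter, decide_eq_true_eq]
      have := @hAB e
      tauto
  have hplus : 0 ≤ plus j (inducedList T D) := by
    refine plus_nonneg j fun t ht => ?_
    obtain ⟨e, -, rfl⟩ := List.mem_map.1 ht
    exact inducedTransfer_v_nonneg hT e
  have hminus : minus j (inducedList T D) = 0 := by
    refine minus_eq_zero j fun t ht => ?_
    obtain ⟨e, he, rfl⟩ := List.mem_map.1 ht
    simp only [hD, List.mem_filter, decide_eq_true_eq] at he
    exact fun h => he.2 (hj e he.1 h)
  have happ : inducedList T (A ++ D) = inducedList T A ++ inducedList T D := by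
    simp [inducedList]
  have hBD : acc init j (inducedList T B) = acc init j (inducedList T (A ++ D)) :=
    acc_perm init j (hperm.map _)
  rw [hBD, happ]
  unfold acc
  rw [plus_append, minus_append]
  linarith

theorem FIFO.mem_of_lt {n : ℕ} {S : List (Fin n × ℕ)} (hS : FIFO S) {p : Fin n} {m m' : ℕ}
    (h : (p, m) ∈ S) (hm : m' < m) : (p, m') ∈ S := by
  obtain ⟨z, hz, hzz⟩ := List.mem_iff_getElem.1 h
  obtain ⟨z', hz', -, h'⟩ := hS z hz m' (by rw [hzz]; exact hm)
  rw [hzz] at h'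
  exact h' ▸ List.getElem_mem hz'

theorem Valid.append_singleton {n : ℕ} {init : Fin n → ℤ} {T : Fin n → List (Fin n × ℤ)}
    {S : List (Fin n × ℕ)} (hS : Valid init T S) {e : Fin n × ℕ} (he : e ∉ S)
    (hlt : e.2 < (T e.1).length) (hfifo : ∀ m' < e.2, (e.1, m') ∈ S)
    (hbal : (inducedTransfer T e).v ≤ acc init e.1 (inducedList T S)) :
    Valid init T (S ++ [e]) := by
  obtain ⟨⟨hnd, hev⟩, hF, hB⟩ := hS
  refine ⟨⟨?_, ?_⟩, ?_, ?_⟩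
  · exact List.Nodup.append hnd (List.nodup_singleton e) (by simpa using he)
  · intro x hx
    rcases List.mem_append.1 hx with hx | hx
    · exact hev x hx
    · rw [List.mem_singleton.1 hx]
      exact hlt
  · intro z hz m' hm'
    rcases Nat.lt_or_ge z S.length with h | h
    · rw [List.getElem_append_left h] at hm' ⊢
      obtain ⟨z', hz', hlt', heq⟩ := hF z h m' hm'
      exact ⟨z', by simp; omega, hlt', by rw [List.getElem_append_left hz', heq]⟩
    · obtain rfl : z = S.length := by simp at hz; omega
      simp only [List.getElem_concat_length] at hm' ⊢
      obtain ⟨z', hz', heq⟩ := List.mem_iff_getElem.1 (hfifo m' hm')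
      exact ⟨z', by simp; omega, hz', by rw [List.getElem_append_left hz', heq]⟩
  · intro z hz
    rcases Nat.lt_or_ge z S.length with h | h
    · rw [List.getElem_append_left h, List.take_append_of_le_length h.le]
      exact hB z h
    · obtain rfl : z = S.length := by simp at hz; omega
      simpa using hbal

/-- every maximal valid processing sequence contains every
event occurring in any valid processing sequence. -/
theorem maximal_contains_all (n : ℕ) (init : Fin n → ℤ)
    (T : Fin n → List (Fin n × ℤ))
    (hinit : ∀ j, 0 ≤ init j) (hT : ∀ p : Fin n, ∀ x ∈ T p, 0 ≤ x.2)
    (S S' : List (Fin n × ℕ))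
    (hS : Valid init T S) (hS' : MaximalValid init T S') :
    ∀ e ∈ S, e ∈ S' := by
  obtain ⟨⟨hnd, hev⟩, hF, hB⟩ := hS
  obtain ⟨hV', hmax⟩ := hS'
  have key : ∀ z (hz : z < S.length), S[z] ∈ S' := by
    intro z
    induction z using Nat.strong_induction_on with
    | _ z ih =>
      intro hz
      by_contra hnot
      have hprev : ∀ m' < S[z].2, (S[z].1, m') ∈ S.take z := by
        intro m' hm'
        obtain ⟨z', hz', hlt, heq⟩ := hF z hz m' hm'
        rw [← heq]
        exact List.mem_take_iff_getElem.2 ⟨z', by omega, rfl⟩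
      have hsub : S.take z ⊆ S' := by
        intro x hx
        obtain ⟨i, hi, rfl⟩ := List.mem_take_iff_getElem.1 hx
        exact ih i (by omega) (by omega)
      refine hmax S[z] hnot (hV'.append_singleton hnot (hev _ (List.getElem_mem hz))
        (fun m' hm' => hsub (hprev m' hm')) ((hB z hz).trans ?_))
      refine acc_le_acc_of_subset init hT (hnd.sublist (List.take_sublist _ _)) hV'.1.1 hsub ?_
      rintro ⟨p, m⟩ hmem rfl
      rcases lt_trichotomy m S[z].2 with h | h | h
      · exact hprev m h
      · subst h
        exact absurd hmem hnot
      · exact absurd (hV'.2.1.mem_of_lt hmem h) hnot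
  intro e he
  obtain ⟨z, hz, rfl⟩ := List.mem_iff_getElem.1 he
  exact key z hz
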